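/- In a finite two-player zero-sum game, if μ is an (exact) coarse correlated equilibrium, then for each player i the expected utility under μ equals the utility of the marginal strategy profile: E_{ρ∼μ}[u_i(ρ)] = u_i(s^μ). -/

import Mathlib

open Finset

/-- A probability distribution on a finite type, represented as a nonnegative
real-valued function summing to one. -/
def IsDist {α : Type*} [Fintype α] (p : α → ℝ) : Prop :=
  (∀ x, 0 ≤ p x) ∧ ∑ x, p x = 1

/-- The marginal of a joint distribution `μ` on the first player's pure strategies. -/
def marg1 {P₁ P₂ : Type*} [Fintype P₁] [Fintype P₂] (μ : P₁ × P₂ → ℝ) : P₁ → ℝ :=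
  fun a => ∑ b, μ (a, b)

/-- The marginal of a joint distribution `μ` on the second player's pure strategies. -/
def marg2 {P₁ P₂ : Type*} [Fintype P₁] [Fintype P₂] (μ : P₁ × P₂ → ℝ) : P₂ → ℝ :=
  fun b => ∑ a, μ (a, b)

/-- Expected utility when the players independently play mixed strategies `s₁` and `s₂`. -/
def mixedU {P₁ P₂ : Type*} [Fintype P₁] [Fintype P₂]
    (u : P₁ × P₂ → ℝ) (s₁ : P₁ → ℝ) (s₂ : P₂ → ℝ) : ℝ :=
  ∑ a, ∑ b, s₁ a * s₂ b * u (a, b)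

/-- Expected utility when player 1 plays mixed strategy `s₁` and player 2 plays
the pure strategy `b`. -/
def mixedU1 {P₁ P₂ : Type*} [Fintype P₁] [Fintype P₂]
    (u : P₁ × P₂ → ℝ) (s₁ : P₁ → ℝ) (b : P₂) : ℝ :=
  ∑ a, s₁ a * u (a, b)

/-- Expected utility when player 1 plays the pure strategy `a` and player 2 plays
mixed strategy `s₂`. -/
def mixedU2 {P₁ P₂ : Type*} [Fintype P₁] [Fintype P₂]
    (u : P₁ × P₂ → ℝ) (a : P₁) (s₂ : P₂ → ℝ) : ℝ :=
  ∑ b, s₂ b * u (a, b)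

/-- Expectation of `f(ρ)` for `ρ ~ μ`, `μ` a joint distribution over pure strategy profiles. -/
def expect {P₁ P₂ : Type*} [Fintype P₁] [Fintype P₂]
    (μ : P₁ × P₂ → ℝ) (f : P₁ × P₂ → ℝ) : ℝ :=
  ∑ ρ, μ ρ * f ρ

/-- `μ` is an ε-coarse correlated equilibrium of the two-player game with utilities
`u₁, u₂`: no player can gain more than `ε` in expectation by deviating to any fixed
mixed strategy while the opponent's pure strategy is drawn from `μ`. -/
def IsCCE {P₁ P₂ : Type*} [Fintype P₁] [Fintype P₂]
    (ε : ℝ) (u₁ u₂ : P₁ × P₂ → ℝ) (μ : P₁ × P₂ → ℝ) : Prop :=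
  (∀ s₁' : P₁ → ℝ, IsDist s₁' → expect μ (fun ρ => mixedU1 u₁ s₁' ρ.2 - u₁ ρ) ≤ ε) ∧
  (∀ s₂' : P₂ → ℝ, IsDist s₂' → expect μ (fun ρ => mixedU2 u₂ ρ.1 s₂' - u₂ ρ) ≤ ε)

theorem expect_sub {P₁ P₂ : Type*} [Fintype P₁] [Fintype P₂] (μ f g : P₁ × P₂ → ℝ) :
    expect μ (fun ρ => f ρ - g ρ) = expect μ f - expect μ g := by
  simp [_root_.expect, mul_sub, Finset.sum_sub_distrib]

theorem expect_neg {P₁ P₂ : Type*} [Fintype P₁] [Fintype P₂] (μ f : P₁ × P₂ → ℝ) :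
    expect μ (fun ρ => -f ρ) = -expect μ f := by
  simp [_root_.expect]

theorem mixedU_neg {P₁ P₂ : Type*} [Fintype P₁] [Fintype P₂] (u : P₁ × P₂ → ℝ)
    (s₁ : P₁ → ℝ) (s₂ : P₂ → ℝ) :
    mixedU (fun ρ => -u ρ) s₁ s₂ = -mixedU u s₁ s₂ := by
  simp [mixedU]

theorem IsDist.marg1 {P₁ P₂ : Type*} [Fintype P₁] [Fintype P₂] {μ : P₁ × P₂ → ℝ}
    (hμ : IsDist μ) : IsDist (marg1 μ) :=
  ⟨fun _ => Finset.sum_nonneg fun _ _ => hμ.1 _, by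
    simpa only [_root_.marg1, Fintype.sum_prod_type] using hμ.2⟩

theorem IsDist.marg2 {P₁ P₂ : Type*} [Fintype P₁] [Fintype P₂] {μ : P₁ × P₂ → ℝ}
    (hμ : IsDist μ) : IsDist (marg2 μ) :=
  ⟨fun _ => Finset.sum_nonneg fun _ _ => hμ.1 _, by
    simpa only [_root_.marg2, Fintype.sum_prod_type_right] using hμ.2⟩

theorem expect_mixedU1 {P₁ P₂ : Type*} [Fintype P₁] [Fintype P₂] (u μ : P₁ × P₂ → ℝ)
    (s₁ : P₁ → ℝ) :
    expect μ (fun ρ => mixedU1 u s₁ ρ.2) = mixedU u s₁ (marg2 μ) := by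
  simp only [_root_.expect, mixedU, mixedU1, marg2, Fintype.sum_prod_type_right]
  rw [Finset.sum_comm (s := (Finset.univ : Finset P₁))]
  refine Finset.sum_congr rfl fun b _ => ?_
  rw [← Finset.sum_mul, Finset.mul_sum]
  exact Finset.sum_congr rfl fun a _ => by ring

theorem expect_mixedU2 {P₁ P₂ : Type*} [Fintype P₁] [Fintype P₂] (u μ : P₁ × P₂ → ℝ)
    (s₂ : P₂ → ℝ) :
    expect μ (fun ρ => mixedU2 u ρ.1 s₂) = mixedU u (marg1 μ) s₂ := by
  simp only [_root_.expect, mixedU, mixedU2, marg1, Fintype.sum_prod_type]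
  refine Finset.sum_congr rfl fun a _ => ?_
  rw [← Finset.sum_mul, Finset.mul_sum]
  exact Finset.sum_congr rfl fun b _ => by ring

/-- in a finite two-player zero-sum game, if `μ` is an exact CCE then for
each player the expected utility under `μ` equals the utility of the marginal strategy
profile. -/
theorem expect_eq_marginal_of_cce {P₁ P₂ : Type*} [Fintype P₁] [Fintype P₂]
    [Nonempty P₁] [Nonempty P₂]
    (u₁ u₂ : P₁ × P₂ → ℝ) (hzs : ∀ ρ : P₁ × P₂, u₁ ρ + u₂ ρ = 0)
    (μ : P₁ × P₂ → ℝ) (hμ : IsDist μ)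
    (hcce : IsCCE 0 u₁ u₂ μ) :
    expect μ u₁ = mixedU u₁ (marg1 μ) (marg2 μ) ∧
    expect μ u₂ = mixedU u₂ (marg1 μ) (marg2 μ) := by
  obtain rfl : u₂ = fun ρ => -u₁ ρ := funext fun ρ => by linarith [hzs ρ]
  have h₁ := hcce.1 _ hμ.marg1
  have h₂ := hcce.2 _ hμ.marg2
  rw [expect_sub, expect_mixedU1] at h₁
  rw [expect_sub, expect_mixedU2, expect_neg, mixedU_neg] at h₂
  rw [expect_neg, mixedU_neg]
  constructor <;> linarith
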